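/- Let j := !![0, i; i, 0] ∈ Matrix (Fin 2) (Fin 2) ℂ. Then for every z ∈ Matrix (Fin 2) (Fin 2) ℂ with det z = 1 one has det(j·z) = 1 and δ(j·z) = −δ(z). Moreover δ is surjective onto ℝ on SL(2,ℂ): for every r ∈ ℝ there exists z ∈ Matrix (Fin 2) (Fin 2) ℂ with det z = 1 and δ(z) = r. -/

import Mathlib

open Matrix Complex

/-- The `SL(2,ℝ) × SL(2,ℝ)`-invariant function `δ(z) = Re(det(z + z̄)) − 2` on
`2×2` complex matrices. -/
noncomputable def deltaFun (z : Matrix (Fin 2) (Fin 2) ℂ) : ℝ :=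
  ((z + z.map (starRingEnd ℂ)).det).re - 2

/-- Multiplication by `j = !![0, i; i, 0]` preserves `SL(2,ℂ)` and changes the sign of
`δ`; moreover `δ` attains every real value on `SL(2,ℂ)`. -/
theorem delta_sign_flip_and_surjective :
    (∀ z : Matrix (Fin 2) (Fin 2) ℂ, z.det = 1 →
      ((!![0, Complex.I; Complex.I, 0] * z).det = 1 ∧
        deltaFun (!![0, Complex.I; Complex.I, 0] * z) = - deltaFun z)) ∧
    (∀ r : ℝ, ∃ z : Matrix (Fin 2) (Fin 2) ℂ, z.det = 1 ∧ deltaFun z = r) := by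
  refine ⟨fun z hz => ⟨?_, ?_⟩, fun r => ?_⟩
  · rw [Matrix.det_mul, hz, Matrix.det_fin_two_of]
    simp
  · rw [Matrix.det_fin_two] at hz
    have h := congrArg Complex.re hz
    simp at h
    simp [deltaFun, Matrix.det_fin_two, Matrix.vecMul, dotProduct, Fin.sum_univ_two]
    linarith
  · refine ⟨!![1, (((r + 2) / 4 - 1 : ℝ) : ℂ) * Complex.I; -Complex.I, (((r + 2) / 4 : ℝ) : ℂ)],
      ?_, ?_⟩
    · rw [Matrix.det_fin_two_of]
      push_cast
      linear_combination (((r : ℂ) + 2) / 4 - 1) * Complex.I_mul_I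
    · simp only [deltaFun, Matrix.det_fin_two]
      simp [-Complex.ofReal_div, -Complex.ofReal_add, -Complex.ofReal_sub]
      ring
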